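/- Let $T>0$ and let $\alpha\in C^1[0,T]$ satisfy $0<\alpha_*\le\alpha(t)\le\alpha^*<1$ on $[0,T]$. Let $g:[0,T]\to\mathbb{R}$ be continuous. Then for every $t\in(0,T)$ the function $\tau\mapsto \int_0^\tau \frac{(\tau-s)^{-\alpha(\tau)}}{\Gamma(1-\alpha(\tau))}\Big(\int_0^s \frac{(s-y)^{\alpha(y)-1}}{\Gamma(\alpha(y))}g(y)\,dy\Big)ds$ is differentiable at $t$ with derivative $g(t)+\int_0^t \partial_t\Big(\frac{(t-y)^{\alpha(y)-\alpha(t)}}{\Gamma(1-\alpha(t)+\alpha(y))}\Big)\,g(y)\,dy$; that is, $\hat D_t^{\alpha(t)} I_t^{\alpha(t)} g(t)= g(t)+\int_0^t \partial_t\frac{(t-y)^{\alpha(y)-\alpha(t)}}{\Gamma(1-\alpha(t)+\alpha(y))}\,g(y)\,dy$. -/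

import Mathlib

open Set MeasureTheory Filter
open scoped Topology

/-- Differentiation of `τ ↦ ∫₀^τ k(y, τ) dy` at an interior point when `∂_τ k = n` is dominated by
an integrable decreasing function of `τ - y`. -/
theorem hasDerivAt_integral_of_antitone_bound {T t C ℓ : ℝ} {k n : ℝ → ℝ → ℝ} {φ : ℝ → ℝ}
    (ht : t ∈ Ioo 0 T)
    (hk : ContinuousOn (Function.uncurry k) {p | 0 < p.1 ∧ p.1 < p.2 ∧ p.2 < T})
    (hkC : ∀ y τ, 0 < y → y < τ → τ < T → |k y τ| ≤ C)
    (hkn : ∀ y τ, 0 < y → y < τ → τ < T → HasDerivAt (k y) (n y τ) τ)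
    (hn : ContinuousOn (Function.uncurry n) {p | 0 < p.1 ∧ p.1 < p.2 ∧ p.2 < T})
    (hnφ : ∀ y τ, 0 < y → y < τ → τ < T → |n y τ| ≤ φ (τ - y))
    (hφ : AntitoneOn φ (Ioo 0 T)) (hφi : IntegrableOn φ (Ioo 0 T))
    (hℓ : Tendsto (Function.uncurry k) (𝓝[{p | p.1 < p.2}] (t, t)) (𝓝 ℓ)) :
    HasDerivAt (fun τ => ∫ y in (0 : ℝ)..τ, k y τ) (ℓ + ∫ y in (0 : ℝ)..t, n y t) t := by
  have hslice : ∀ {f : ℝ → ℝ → ℝ} {τ : ℝ},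
      ContinuousOn (Function.uncurry f) {p | 0 < p.1 ∧ p.1 < p.2 ∧ p.2 < T} → τ < T →
      ContinuousOn (fun y => f y τ) (Ioo 0 τ) := by
    intro f τ hf hτ
    exact hf.comp (f := fun y => (y, τ)) (by fun_prop) fun y hy => ⟨hy.1, hy.2, hτ⟩
  have hinteg : ∀ {τ : ℝ}, 0 < τ → τ < T → IntervalIntegrable (fun y => k y τ) volume 0 τ := by
    intro τ h0 hτ
    rw [intervalIntegrable_iff_integrableOn_Ioo_of_le h0.le]
    refine Integrable.of_bound (C := C)
      ((hslice hk hτ).aestronglyMeasurable measurableSet_Ioo) ?_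
    filter_upwards [ae_restrict_mem measurableSet_Ioo] with y hy
    exact hkC y τ hy.1 hy.2 hτ
  set Q : ℝ → ℝ → ℝ → ℝ := fun m M => (Ioo 0 m).indicator
    fun u => (k (m - u) M - k (m - u) m) / (M - m)
  have hQ : ∀ m M u, Q m M u =
      (Ioo 0 m).indicator (fun u => (k (m - u) M - k (m - u) m) / (M - m)) u := fun _ _ _ => rfl
  have hquot : ∀ m M, 0 < m → m < M → M < T →
      ((∫ y in (0 : ℝ)..M, k y M) - ∫ y in (0 : ℝ)..m, k y m) / (M - m)
        = (∫ y in m..M, k y M) / (M - m) + ∫ u, Q m M u := by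
    intro m M h0 hmM hM
    have hiM := hinteg (h0.trans hmM) hM
    have hsub1 : IntervalIntegrable (fun y => k y M) volume 0 m :=
      hiM.mono_set (by rw [uIcc_of_le h0.le, uIcc_of_le (h0.trans hmM).le]
                       exact Icc_subset_Icc_right hmM.le)
    have hsub2 : IntervalIntegrable (fun y => k y M) volume m M :=
      hiM.mono_set (by rw [uIcc_of_le hmM.le, uIcc_of_le (h0.trans hmM).le]
                       exact Icc_subset_Icc_left h0.le)
    have hQi : ∫ u, Q m M u = (∫ y in (0 : ℝ)..m, (k y M - k y m)) / (M - m) := by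
      rw [integral_indicator measurableSet_Ioo, ← integral_Ioc_eq_integral_Ioo,
        ← intervalIntegral.integral_of_le h0.le, intervalIntegral.integral_div]
      congr 1
      simpa using intervalIntegral.integral_comp_sub_left (a := 0) (b := m)
        (fun y => k y M - k y m) m
    rw [hQi, intervalIntegral.integral_sub hsub1 (hinteg h0 (hmM.trans hM)),
      ← intervalIntegral.integral_add_adjacent_intervals hsub1 hsub2]
    ring
  have hmvt : ∀ m M u, 0 < u → u < m → m < M → M < T →
      ∃ ξ ∈ Ioo m M, n (m - u) ξ = (k (m - u) M - k (m - u) m) / (M - m) := by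
    intro m M u hu hum hmM hM
    refine exists_hasDerivAt_eq_slope (k (m - u)) (n (m - u)) hmM ?_ ?_
    · intro x hx
      exact (hkn _ x (by linarith) (by linarith [hx.1]) (hx.2.trans_lt hM)
        ).continuousAt.continuousWithinAt
    · intro x hx
      exact hkn _ x (by linarith) (by linarith [hx.1]) (hx.2.trans hM)
  have hm : Tendsto (fun τ => min τ t) (𝓝[≠] t) (𝓝 t) :=
    ((continuous_id.min continuous_const).tendsto' t t (by simp)).mono_left nhdsWithin_le_nhds
  have hM : Tendsto (fun τ => max τ t) (𝓝[≠] t) (𝓝 t) :=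
    ((continuous_id.max continuous_const).tendsto' t t (by simp)).mono_left nhdsWithin_le_nhds
  have hev : ∀ᶠ τ in 𝓝[≠] t, 0 < min τ t ∧ min τ t < max τ t ∧ max τ t < T := by
    filter_upwards [hm.eventually (lt_mem_nhds ht.1), hM.eventually (gt_mem_nhds ht.2),
      self_mem_nhdsWithin] with τ h1 h2 h3
    exact ⟨h1, min_lt_max.2 h3, h2⟩
  rw [hasDerivAt_iff_tendsto_slope]
  have hslope : ∀ᶠ τ in 𝓝[≠] t, (∫ y in (min τ t)..(max τ t), k y (max τ t)) /
      (max τ t - min τ t) + ∫ u, Q (min τ t) (max τ t) u =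
      slope (fun τ => ∫ y in (0 : ℝ)..τ, k y τ) t τ := by
    filter_upwards [hev, self_mem_nhdsWithin] with τ ⟨h0, h1, h2⟩ h3
    rw [← hquot _ _ h0 h1 h2, slope_def_field]
    rcases lt_or_gt_of_ne h3 with h | h
    · rw [min_eq_left h.le, max_eq_right h.le, ← neg_div_neg_eq, neg_sub, neg_sub]
    · rw [min_eq_right h.le, max_eq_left h.le]
  refine Tendsto.congr' hslope (Tendsto.add ?_ ?_)
  · rw [Metric.tendsto_nhds]
    intro ε hε
    rw [Metric.tendsto_nhdsWithin_nhds] at hℓ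
    obtain ⟨δ, hδ, hkδ⟩ := hℓ (ε / 2) (half_pos hε)
    filter_upwards [hev, hm.eventually (Metric.ball_mem_nhds t hδ),
      hM.eventually (Metric.ball_mem_nhds t hδ)] with τ ⟨h0, h1, h2⟩ h3 h4
    set a := min τ t
    set b := max τ t
    have hab : 0 < b - a := sub_pos.2 h1
    have hiM := hinteg (h0.trans h1) h2
    have hsub2 : IntervalIntegrable (fun y => k y b) volume a b :=
      hiM.mono_set (by rw [uIcc_of_le h1.le, uIcc_of_le (h0.trans h1).le]
                       exact Icc_subset_Icc_left h0.le)
    have key : ‖∫ y in a..b, (k y b - ℓ)‖ ≤ ε / 2 * |b - a| := by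
      refine intervalIntegral.norm_integral_le_of_norm_le_const_ae ?_
      have : ∀ᵐ y : ℝ, y ≠ b := by simp [ae_iff]
      filter_upwards [this] with y hy hyab
      rw [uIoc_of_le h1.le] at hyab
      have hyb : y < b := lt_of_le_of_ne hyab.2 hy
      have := hkδ (x := (y, b)) hyb ?_
      · exact (this.le)
      · rw [Prod.dist_eq, max_lt_iff]
        refine ⟨?_, h4⟩
        simp only [Real.dist_eq, abs_lt] at h3 h4 ⊢
        constructor <;> linarith [hyab.1]
    rw [intervalIntegral.integral_sub hsub2 (by simp), intervalIntegral.integral_const,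
      smul_eq_mul, abs_of_pos hab] at key
    rw [Real.dist_eq, div_sub' hab.ne', abs_div, abs_of_pos hab, div_lt_iff₀ hab]
    calc _ ≤ ε / 2 * (b - a) := key
      _ < ε * (b - a) := by nlinarith
  · have hlim : ∫ y in (0 : ℝ)..t, n y t =
        ∫ u, (Ioo 0 t).indicator (fun u => n (t - u) t) u := by
      rw [integral_indicator measurableSet_Ioo, ← integral_Ioc_eq_integral_Ioo,
        ← intervalIntegral.integral_of_le ht.1.le]
      simpa using (intervalIntegral.integral_comp_sub_left (a := 0) (b := t)
        (fun y => n y t) t).symm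
    rw [hlim]
    refine tendsto_integral_filter_of_dominated_convergence ((Ioo 0 T).indicator φ) ?_ ?_
      ((integrable_indicator_iff measurableSet_Ioo).2 hφi) ?_
    · filter_upwards [hev] with τ ⟨h0, h1, h2⟩
      refine (aestronglyMeasurable_indicator_iff measurableSet_Ioo).2
        (ContinuousOn.aestronglyMeasurable ?_ measurableSet_Ioo)
      refine ContinuousOn.div_const (ContinuousOn.sub ?_ ?_) _
      · exact (hslice hk h2).comp (f := fun u => min τ t - u) (by fun_prop)
          fun u hu => ⟨by linarith [hu.2], by linarith [hu.1]⟩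
      · exact (hslice hk (h1.trans h2)).comp (f := fun u => min τ t - u) (by fun_prop)
          fun u hu => ⟨by linarith [hu.2], by linarith [hu.1]⟩
    · filter_upwards [hev] with τ ⟨h0, h1, h2⟩
      refine Eventually.of_forall fun u => ?_
      rw [hQ]
      by_cases hu : u ∈ Ioo 0 (min τ t)
      · rw [indicator_of_mem hu, indicator_of_mem (show u ∈ Ioo 0 T from ⟨hu.1, by linarith [hu.2]⟩)]
        obtain ⟨ξ, hξ, he⟩ := hmvt _ _ u hu.1 hu.2 h1 h2
        rw [← he, Real.norm_eq_abs]
        have hu1 : u ∈ Ioo 0 T := ⟨hu.1, by linarith [hu.2]⟩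
        have hu2 : ξ - (min τ t - u) ∈ Ioo 0 T := by
          constructor <;> linarith [hu.1, hu.2, hξ.1, hξ.2]
        exact (hnφ _ ξ (by linarith [hu.2]) (by linarith [hu.1, hξ.1])
          (hξ.2.trans h2)).trans (hφ hu1 hu2 (by linarith [hξ.1]))
      · rw [indicator_of_notMem hu, norm_zero]
        by_cases hu' : u ∈ Ioo 0 T
        · rw [indicator_of_mem hu']
          have h5 : 0 < (T - u) / 2 := by linarith [hu'.2]
          have := hnφ ((T - u) / 2) ((T - u) / 2 + u) h5 (by linarith [hu'.1])
            (by linarith [hu'.2])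
          rw [add_sub_cancel_left] at this
          exact (abs_nonneg _).trans this
        · rw [indicator_of_notMem hu']
    · have : ∀ᵐ u : ℝ, u ≠ t := by simp [ae_iff]
      filter_upwards [this] with u hut
      rcases lt_or_gt_of_ne hut with hlt | hgt
      · by_cases hu : 0 < u
        · rw [indicator_of_mem (show u ∈ Ioo 0 t from ⟨hu, hlt⟩), Metric.tendsto_nhds]
          intro ε hε
          have hopen : IsOpen {p : ℝ × ℝ | 0 < p.1 ∧ p.1 < p.2 ∧ p.2 < T} :=
            (isOpen_lt continuous_const continuous_fst).inter
              ((isOpen_lt continuous_fst continuous_snd).inter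
                (isOpen_lt continuous_snd continuous_const))
          have hca : ContinuousAt (Function.uncurry n) (t - u, t) :=
            hn.continuousAt (hopen.mem_nhds ⟨sub_pos.2 hlt, sub_lt_self t hu, ht.2⟩)
          obtain ⟨δ, hδ, hnδ⟩ := Metric.continuousAt_iff.1 hca ε hε
          filter_upwards [hev, hm.eventually (Metric.ball_mem_nhds t hδ),
            hM.eventually (Metric.ball_mem_nhds t hδ),
            hm.eventually (lt_mem_nhds hlt)] with τ ⟨h0, h1, h2⟩ h3 h4 h5
          rw [hQ, indicator_of_mem (show u ∈ Ioo 0 (min τ t) from ⟨hu, h5⟩)]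
          obtain ⟨ξ, hξ, he⟩ := hmvt _ _ u hu h5 h1 h2
          rw [← he]
          refine hnδ (x := (min τ t - u, ξ)) ?_
          rw [Prod.dist_eq, max_lt_iff]
          simp only [Real.dist_eq, abs_lt] at h3 h4 ⊢
          refine ⟨⟨?_, ?_⟩, ?_, ?_⟩ <;> linarith [hξ.1, hξ.2]
        · simp [hQ, hu]
      · rw [indicator_of_notMem (fun h => hgt.not_gt h.2)]
        refine tendsto_const_nhds.congr fun τ => ?_
        rw [hQ, indicator_of_notMem]
        exact fun h => absurd (h.2.trans_le (min_le_right τ t)) hgt.not_gt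

theorem contDiff_inv_Gamma {n : WithTop ℕ∞} : ContDiff ℝ n fun x : ℝ => (Real.Gamma x)⁻¹ := by
  have h := (Complex.differentiable_one_div_Gamma.contDiff (n := n)).real_of_complex
  have he : (fun x : ℝ => (Real.Gamma x)⁻¹) = fun x : ℝ => ((Complex.Gamma x)⁻¹).re := by
    ext x
    rw [Complex.Gamma_ofReal, ← Complex.ofReal_inv, Complex.ofReal_re]
  rw [he]
  exact h

theorem integral_rpow_mul_rpow_eq_Gamma {p q y τ : ℝ} (hp : 0 < p) (hq : 0 < q) (h : y < τ) :
    ∫ s in y..τ, (τ - s) ^ (q - 1) * (s - y) ^ (p - 1) =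
      (τ - y) ^ (p + q - 1) * (Real.Gamma p * Real.Gamma q / Real.Gamma (p + q)) := by
  have h0 : 0 < τ - y := sub_pos.2 h
  have hs := Complex.betaIntegral_scaled p q h0
  have hb : Complex.betaIntegral p q =
      ((Real.Gamma p * Real.Gamma q / Real.Gamma (p + q) : ℝ) : ℂ) := by
    rw [Complex.betaIntegral_eq_Gamma_mul_div _ _ (by simpa) (by simpa), ← Complex.ofReal_add]
    simp_rw [Complex.Gamma_ofReal]
    norm_cast
  have hl : ∫ x in (0 : ℝ)..(τ - y), (x : ℂ) ^ ((p : ℂ) - 1) *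
      (((τ - y : ℝ) : ℂ) - x) ^ ((q : ℂ) - 1) =
      ((∫ x in (0 : ℝ)..(τ - y), x ^ (p - 1) * (τ - y - x) ^ (q - 1) : ℝ) : ℂ) := by
    rw [← intervalIntegral.integral_ofReal]
    refine intervalIntegral.integral_congr fun x hx => ?_
    rw [uIcc_of_le h0.le] at hx
    rw [Complex.ofReal_mul, Complex.ofReal_cpow hx.1, Complex.ofReal_cpow (by linarith [hx.2])]
    push_cast
    rfl
  rw [hl, hb] at hs
  have hr : ((τ - y : ℝ) : ℂ) ^ ((p : ℂ) + q - 1) = (((τ - y) ^ (p + q - 1) : ℝ) : ℂ) := by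
    rw [Complex.ofReal_cpow h0.le]; push_cast; rfl
  rw [hr, ← Complex.ofReal_mul, Complex.ofReal_inj] at hs
  have hc := intervalIntegral.integral_comp_sub_right (a := y) (b := τ)
    (fun x => x ^ (p - 1) * (τ - y - x) ^ (q - 1)) y
  rw [sub_self] at hc
  rw [← hs, ← hc]
  refine intervalIntegral.integral_congr fun x _ => ?_
  rw [mul_comm, show τ - y - (x - y) = τ - x by ring]

theorem intervalIntegrable_rpow_mul_rpow {p q y τ : ℝ} (hp : 0 < p) (hq : 0 < q) (h : y < τ) :
    IntervalIntegrable (fun s => (τ - s) ^ (q - 1) * (s - y) ^ (p - 1)) volume y τ := by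
  by_contra hc
  have h1 := integral_rpow_mul_rpow_eq_Gamma hp hq h
  rw [intervalIntegral.integral_undef hc] at h1
  have := Real.Gamma_pos_of_pos hp
  have := Real.Gamma_pos_of_pos hq
  have := Real.Gamma_pos_of_pos (add_pos hp hq)
  have := Real.rpow_pos_of_pos (sub_pos.2 h) (p + q - 1)
  exact absurd h1 (by positivity)

/-- Composition of the two variable-exponent fractional integrals, by Fubini and Euler's beta
integral. -/
theorem integral_rpow_mul_integral_rpow_eq {τ a C : ℝ} {α g : ℝ → ℝ} (hτ : 0 < τ) (ha : a < 1)
    (hα : ContinuousOn α (Icc 0 τ)) (hα0 : ∀ y ∈ Icc 0 τ, 0 < α y)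
    (hg : ContinuousOn g (Icc 0 τ))
    (hC : ∀ y, 0 < y → y < τ →
      |(τ - y) ^ (α y - a) / Real.Gamma (1 - a + α y)| ≤ C) :
    ∫ s in (0 : ℝ)..τ, (τ - s) ^ (-a) / Real.Gamma (1 - a) *
        ∫ y in (0 : ℝ)..s, (s - y) ^ (α y - 1) / Real.Gamma (α y) * g y =
      ∫ y in (0 : ℝ)..τ, (τ - y) ^ (α y - a) / Real.Gamma (1 - a + α y) * g y := by
  have hsub : Ioo 0 τ ⊆ Icc 0 τ := Ioo_subset_Icc_self
  have hGa : 0 < Real.Gamma (1 - a) := Real.Gamma_pos_of_pos (by linarith)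
  set Δ : Set (ℝ × ℝ) := {p | 0 < p.2 ∧ p.2 < p.1 ∧ p.1 < τ}
  have hΔ : IsOpen Δ := (isOpen_lt continuous_const continuous_snd).inter
    ((isOpen_lt continuous_snd continuous_fst).inter (isOpen_lt continuous_fst continuous_const))
  set κ : ℝ → ℝ → ℝ := fun s y => (τ - s) ^ (-a) / Real.Gamma (1 - a) *
    ((s - y) ^ (α y - 1) / Real.Gamma (α y)) with hκ
  set f : ℝ → ℝ → ℝ := fun s y => Δ.indicator (fun p => κ p.1 p.2 * g p.2) (s, y) with hf
  have hcont : ContinuousOn (fun p : ℝ × ℝ => κ p.1 p.2 * g p.2) Δ := by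
    have h2 : MapsTo (Prod.snd : ℝ × ℝ → ℝ) Δ (Icc 0 τ) :=
      fun p hp => ⟨hp.1.le, (hp.2.1.trans hp.2.2).le⟩
    have hα2 : ContinuousOn (fun p : ℝ × ℝ => α p.2) Δ := hα.comp continuousOn_snd h2
    have hg2 : ContinuousOn (fun p : ℝ × ℝ => g p.2) Δ := hg.comp continuousOn_snd h2
    have hG : ContinuousOn (fun p : ℝ × ℝ => (Real.Gamma (α p.2))⁻¹) Δ :=
      (contDiff_inv_Gamma (n := 0)).continuous.comp_continuousOn hα2
    refine ((ContinuousOn.div_const ?_ _).mul (ContinuousOn.mul ?_ hG)).mul hg2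
    · exact ContinuousOn.rpow (by fun_prop) continuousOn_const
        fun p hp => Or.inl (sub_pos.2 hp.2.2).ne'
    · exact ContinuousOn.rpow (by fun_prop) (hα2.sub continuousOn_const)
        fun p hp => Or.inl (sub_pos.2 hp.2.1).ne'
  have hmeas : AEStronglyMeasurable (Function.uncurry f) (volume.prod volume) :=
    (aestronglyMeasurable_indicator_iff hΔ.measurableSet).2
      (hcont.aestronglyMeasurable hΔ.measurableSet)
  have hfs : ∀ y ∈ Ioo 0 τ, (fun s => f s y) = (Ioo y τ).indicator fun s => κ s y * g y := by
    intro y hy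
    ext s
    by_cases hs : s ∈ Ioo y τ
    · rw [indicator_of_mem hs, hf]; exact indicator_of_mem (show (s, y) ∈ Δ from ⟨hy.1, hs⟩) _
    · rw [indicator_of_notMem hs, hf]
      exact indicator_of_notMem (fun h : (s, y) ∈ Δ => hs h.2) _
  have hfs0 : ∀ y, y ∉ Ioo 0 τ → (fun s => f s y) = 0 := by
    intro y hy
    ext s
    exact indicator_of_notMem (fun h : (s, y) ∈ Δ => hy ⟨h.1, h.2.1.trans h.2.2⟩) _
  have hfy : ∀ s ∈ Ioo 0 τ, (fun y => f s y) = (Ioo 0 s).indicator fun y => κ s y * g y := by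
    intro s hs
    ext y
    by_cases hy : y ∈ Ioo 0 s
    · rw [indicator_of_mem hy, hf]
      exact indicator_of_mem (show (s, y) ∈ Δ from ⟨hy.1, hy.2, hs.2⟩) _
    · rw [indicator_of_notMem hy, hf]
      exact indicator_of_notMem (fun h : (s, y) ∈ Δ => hy ⟨h.1, h.2.1⟩) _
  have hfy0 : ∀ s, s ∉ Ioo 0 τ → (fun y => f s y) = 0 := by
    intro s hs
    ext y
    exact indicator_of_notMem (fun h : (s, y) ∈ Δ => hs ⟨h.1.trans h.2.1, h.2.2⟩) _
  have hκeq : ∀ y, (fun s => κ s y) = fun s => (Real.Gamma (1 - a) * Real.Gamma (α y))⁻¹ *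
      ((τ - s) ^ ((1 - a) - 1) * (s - y) ^ (α y - 1)) := by
    intro y
    ext s
    rw [hκ, show 1 - a - 1 = -a by ring]
    simp only [div_eq_mul_inv, mul_inv]
    ring
  have hκi : ∀ y ∈ Ioo 0 τ, IntegrableOn (fun s => κ s y) (Ioo y τ) := by
    intro y hy
    rw [← intervalIntegrable_iff_integrableOn_Ioo_of_le hy.2.le, hκeq]
    exact (intervalIntegrable_rpow_mul_rpow (hα0 y (hsub hy)) (by linarith) hy.2).const_mul _
  have hκint : ∀ y ∈ Ioo 0 τ, ∫ s in Ioo y τ, κ s y =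
      (τ - y) ^ (α y - a) / Real.Gamma (1 - a + α y) := by
    intro y hy
    have := Real.Gamma_pos_of_pos (hα0 y (hsub hy))
    rw [← integral_Ioc_eq_integral_Ioo, ← intervalIntegral.integral_of_le hy.2.le, hκeq,
      intervalIntegral.integral_const_mul, integral_rpow_mul_rpow_eq_Gamma (hα0 y (hsub hy))
        (by linarith) hy.2, show α y + (1 - a) - 1 = α y - a by ring,
        show α y + (1 - a) = 1 - a + α y by ring]
    field_simp
  have hκnn : ∀ y ∈ Ioo 0 τ, ∀ s ∈ Ioo y τ, 0 ≤ κ s y := by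
    intro y hy s hs
    have := Real.Gamma_pos_of_pos (hα0 y (hsub hy))
    have := Real.rpow_nonneg (sub_pos.2 hs.1).le (α y - 1)
    have := Real.rpow_nonneg (sub_pos.2 hs.2).le (-a)
    rw [hκ]
    positivity
  obtain ⟨G, hG⟩ := isCompact_Icc.exists_bound_of_continuousOn hg
  have hinteg : Integrable (Function.uncurry f) (volume.prod volume) := by
    rw [integrable_prod_iff' hmeas]
    constructor
    · refine Eventually.of_forall fun y => ?_
      by_cases hy : y ∈ Ioo 0 τ
      · change Integrable (fun s => f s y)
        rw [hfs y hy, integrable_indicator_iff measurableSet_Ioo]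
        exact (hκi y hy).mul_const _
      · change Integrable (fun s => f s y)
        rw [hfs0 y hy]
        exact integrable_zero _ _ _
    · have hb : Integrable ((Ioo 0 τ).indicator fun _ : ℝ => C * G) := by
        rw [integrable_indicator_iff measurableSet_Ioo]
        exact integrableOn_const (by simp)
      refine hb.mono' hmeas.norm.prod_swap.integral_prod_right' ?_
      refine Eventually.of_forall fun y => ?_
      rw [Real.norm_of_nonneg (integral_nonneg fun s => norm_nonneg _)]
      by_cases hy : y ∈ Ioo 0 τ
      · have h1 : (fun s => ‖f s y‖) = (Ioo y τ).indicator fun s => κ s y * |g y| := by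
          ext s
          rw [congrFun (hfs y hy) s]
          by_cases hs : s ∈ Ioo y τ
          · rw [indicator_of_mem hs, indicator_of_mem hs, norm_mul,
              Real.norm_of_nonneg (hκnn y hy s hs), Real.norm_eq_abs]
          · rw [indicator_of_notMem hs, indicator_of_notMem hs, norm_zero]
        change ∫ s, ‖f s y‖ ≤ _
        rw [h1, integral_indicator measurableSet_Ioo, integral_mul_const, hκint y hy,
          indicator_of_mem hy]
        have hC' := hC y hy.1 hy.2
        exact mul_le_mul ((le_abs_self _).trans hC') (hG y (hsub hy)) (abs_nonneg _)
          ((abs_nonneg _).trans hC')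
      · change ∫ s, ‖f s y‖ ≤ _
        have h1 : (fun s => ‖f s y‖) = 0 := by
          ext s
          rw [congrFun (hfs0 y hy) s]; simp
        rw [h1, indicator_of_notMem hy]
        simp
  have hswap := integral_integral_swap hinteg
  have hL : ∫ s, ∫ y, f s y = ∫ s in (0 : ℝ)..τ, (τ - s) ^ (-a) / Real.Gamma (1 - a) *
        ∫ y in (0 : ℝ)..s, (s - y) ^ (α y - 1) / Real.Gamma (α y) * g y := by
    rw [intervalIntegral.integral_of_le hτ.le, integral_Ioc_eq_integral_Ioo,
      ← integral_indicator measurableSet_Ioo]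
    congr 1
    ext s
    by_cases hs : s ∈ Ioo 0 τ
    · rw [hfy s hs, indicator_of_mem hs, integral_indicator measurableSet_Ioo,
        ← integral_Ioc_eq_integral_Ioo, ← intervalIntegral.integral_of_le hs.1.le,
        ← intervalIntegral.integral_const_mul]
      simp only [hκ, mul_assoc]
    · rw [hfy0 s hs, indicator_of_notMem hs]
      simp
  have hR : ∫ y, ∫ s, f s y =
      ∫ y in (0 : ℝ)..τ, (τ - y) ^ (α y - a) / Real.Gamma (1 - a + α y) * g y := by
    rw [intervalIntegral.integral_of_le hτ.le, integral_Ioc_eq_integral_Ioo,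
      ← integral_indicator measurableSet_Ioo]
    congr 1
    ext y
    by_cases hy : y ∈ Ioo 0 τ
    · rw [hfs y hy, indicator_of_mem hy, integral_indicator measurableSet_Ioo,
        integral_mul_const, hκint y hy]
    · rw [hfs0 y hy, indicator_of_notMem hy]
      simp
  rw [← hL, hswap, hR]

theorem ContDiffOn.exists_hasDerivAt_bound_Icc {α : ℝ → ℝ} {T : ℝ} (hT : 0 < T)
    (hα : ContDiffOn ℝ 1 α (Icc 0 T)) :
    ∃ (α' : ℝ → ℝ) (A : ℝ), 0 ≤ A ∧ ContinuousOn α' (Icc 0 T) ∧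
      (∀ t ∈ Ioo 0 T, HasDerivAt α (α' t) t) ∧ (∀ t ∈ Icc 0 T, |α' t| ≤ A) ∧
      ∀ x ∈ Icc 0 T, ∀ y ∈ Icc 0 T, |α x - α y| ≤ A * |x - y| := by
  have hd := hα.differentiableOn one_ne_zero
  have hc := hα.continuousOn_derivWithin (uniqueDiffOn_Icc hT) le_rfl
  obtain ⟨A, hA⟩ := isCompact_Icc.exists_bound_of_continuousOn hc
  refine ⟨derivWithin α (Icc 0 T), A, (norm_nonneg _).trans (hA 0 ⟨le_rfl, hT.le⟩), hc, ?_, hA, ?_⟩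
  · intro t ht
    exact (hd t (Ioo_subset_Icc_self ht)).hasDerivWithinAt.hasDerivAt (Icc_mem_nhds ht.1 ht.2)
  · intro x hx y hy
    exact (convex_Icc 0 T).norm_image_sub_le_of_norm_derivWithin_le hd hA hy hx

theorem hasDerivAt_sub_rpow_div_Gamma {α : ℝ → ℝ} {α' y t : ℝ} (hα : HasDerivAt α α' t)
    (hyt : y < t) :
    HasDerivAt (fun τ => (τ - y) ^ (α y - α τ) / Real.Gamma (1 - α τ + α y))
      ((t - y) ^ (α y - α t) * ((-α' * Real.log (t - y) + (α y - α t) / (t - y)) *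
        (Real.Gamma (1 - α t + α y))⁻¹ -
        deriv (fun x : ℝ => (Real.Gamma x)⁻¹) (1 - α t + α y) * α')) t := by
  have hw : 0 < t - y := sub_pos.2 hyt
  have h1 : HasDerivAt (fun τ => (τ - y) ^ (α y - α τ)) _ t :=
    ((hasDerivAt_id t).sub_const y).rpow (hα.const_sub (α y)) hw
  have h2 : HasDerivAt (fun x : ℝ => (Real.Gamma x)⁻¹)
      (deriv (fun x : ℝ => (Real.Gamma x)⁻¹) (1 - α t + α y)) (1 - α t + α y) :=
    ((contDiff_inv_Gamma (n := 1)).differentiable one_ne_zero _).hasDerivAt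
  have h3 : HasDerivAt (fun τ => (Real.Gamma (1 - α τ + α y))⁻¹) _ t :=
    HasDerivAt.comp (h₂ := fun x : ℝ => (Real.Gamma x)⁻¹) t h2 ((hα.const_sub 1).add_const (α y))
  refine (h1.mul h3).congr_deriv ?_
  simp only [id]
  rw [Real.rpow_sub_one hw.ne']
  field_simp
  ring

theorem abs_log_le_two_mul_abs_log_sub_log {w T : ℝ} (hw : 0 < w) (hwT : w ≤ T) :
    |Real.log w| ≤ 2 * |Real.log T| - Real.log w := by
  have h1 := Real.log_le_log hw hwT
  have h2 := le_abs_self (Real.log T)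
  have h3 := abs_nonneg (Real.log T)
  rw [abs_le]
  constructor <;> linarith

theorem exists_rpow_le_of_abs_le_mul (A T : ℝ) (hA : 0 ≤ A) :
    ∃ E, 0 < E ∧ ∀ w e : ℝ, 0 < w → w ≤ T → |e| ≤ A * w → w ^ e ≤ E := by
  obtain ⟨B, hB⟩ := isCompact_Icc.exists_bound_of_continuousOn
    (Real.continuous_mul_log.continuousOn (s := Icc 0 T))
  refine ⟨Real.exp (A * B), Real.exp_pos _, fun w e hw hwT he => ?_⟩
  rw [Real.rpow_def_of_pos hw, Real.exp_le_exp]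
  have h1 := hB w ⟨hw.le, hwT⟩
  rw [Real.norm_eq_abs, abs_mul, abs_of_pos hw] at h1
  calc Real.log w * e ≤ |Real.log w| * |e| := (le_abs_self _).trans (abs_mul _ _).le
    _ ≤ |Real.log w| * (A * w) := by gcongr
    _ = A * (w * |Real.log w|) := by ring
    _ ≤ A * B := by gcongr

theorem tendsto_sub_rpow_div_Gamma_diagonal {α : ℝ → ℝ} {A T t : ℝ} (ht : t ∈ Ioo 0 T)
    (hα : ContinuousAt α t) (hA : ∀ x ∈ Icc 0 T, ∀ y ∈ Icc 0 T, |α x - α y| ≤ A * |x - y|) :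
    Tendsto (fun p : ℝ × ℝ => (p.2 - p.1) ^ (α p.1 - α p.2) / Real.Gamma (1 - α p.2 + α p.1))
      (𝓝[{p | p.1 < p.2}] (t, t)) (𝓝 1) := by
  have hfst : Tendsto Prod.fst (𝓝[{p : ℝ × ℝ | p.1 < p.2}] (t, t)) (𝓝 t) :=
    (continuous_fst.tendsto (t, t)).mono_left nhdsWithin_le_nhds
  have hsnd : Tendsto Prod.snd (𝓝[{p : ℝ × ℝ | p.1 < p.2}] (t, t)) (𝓝 t) :=
    (continuous_snd.tendsto (t, t)).mono_left nhdsWithin_le_nhds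
  have hmem := Icc_mem_nhds ht.1 ht.2
  have hlog : Tendsto (fun p : ℝ × ℝ => A * |(p.2 - p.1) * Real.log (p.2 - p.1)|)
      (𝓝[{p | p.1 < p.2}] (t, t)) (𝓝 0) := by
    have h := ((Real.continuous_mul_log.tendsto (t - t)).comp (hsnd.sub hfst)).abs.const_mul A
    simpa using h
  have hexp : Tendsto (fun p : ℝ × ℝ => Real.log (p.2 - p.1) * (α p.1 - α p.2))
      (𝓝[{p | p.1 < p.2}] (t, t)) (𝓝 0) := by
    refine squeeze_zero_norm' ?_ hlog
    filter_upwards [hfst.eventually hmem, hsnd.eventually hmem, self_mem_nhdsWithin]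
      with p h1 h2 h3
    have h4 := hA _ h1 _ h2
    rw [abs_sub_comm p.1] at h4
    rw [Real.norm_eq_abs, abs_mul, abs_mul]
    calc _ ≤ |Real.log (p.2 - p.1)| * (A * |p.2 - p.1|) := by gcongr
      _ = _ := by ring
  have hpow : Tendsto (fun p : ℝ × ℝ => (p.2 - p.1) ^ (α p.1 - α p.2))
      (𝓝[{p | p.1 < p.2}] (t, t)) (𝓝 1) := by
    have h := (Real.continuous_exp.tendsto 0).comp hexp
    rw [Real.exp_zero] at h
    refine h.congr' ?_
    filter_upwards [self_mem_nhdsWithin] with p hp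
    exact (Real.rpow_def_of_pos (sub_pos.2 hp) _).symm
  have hG : Tendsto (fun p : ℝ × ℝ => (Real.Gamma (1 - α p.2 + α p.1))⁻¹)
      (𝓝[{p | p.1 < p.2}] (t, t)) (𝓝 1) := by
    have h := ((contDiff_inv_Gamma (n := 0)).continuous.tendsto (1 - α t + α t)).comp
      (((hα.tendsto.comp hsnd).const_sub 1).add (hα.tendsto.comp hfst))
    rw [sub_add_cancel, Real.Gamma_one, inv_one] at h
    exact h
  simpa [div_eq_mul_inv] using hpow.mul hG

/-- Approximate inversion for variable-exponent Riemann–Liouville operators: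
`D̂_t^{α(t)} I_t^{α(t)} g(t) = g(t) + ∫_0^t ∂_t ((t-y)^{α(y)-α(t)}/Γ(1-α(t)+α(y))) g(y) dy`. -/
theorem RL_approximate_inversion
    (T : ℝ) (hT : 0 < T) (α : ℝ → ℝ) (αlo αhi : ℝ)
    (hα : ContDiffOn ℝ 1 α (Icc 0 T))
    (hlo : 0 < αlo) (hhi : αhi < 1)
    (hbound : ∀ t ∈ Icc 0 T, αlo ≤ α t ∧ α t ≤ αhi)
    (g : ℝ → ℝ) (hg : ContinuousOn g (Icc 0 T))
    (N : ℝ → ℝ → ℝ)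
    (hN : ∀ y t : ℝ, 0 ≤ y → y < t → t ≤ T →
      HasDerivAt (fun τ => (τ - y) ^ (α y - α τ) / Real.Gamma (1 - α τ + α y)) (N y t) t)
    (t : ℝ) (ht : t ∈ Ioo 0 T) :
    HasDerivAt
      (fun τ => ∫ s in (0:ℝ)..τ, (τ - s) ^ (-α τ) / Real.Gamma (1 - α τ) *
        ∫ y in (0:ℝ)..s, (s - y) ^ (α y - 1) / Real.Gamma (α y) * g y)
      (g t + ∫ y in (0:ℝ)..t, N y t * g y) t := by
  obtain ⟨α', A, hA0, hα'c, hα', hα'A, hLip⟩ := hα.exists_hasDerivAt_bound_Icc hT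
  obtain ⟨E, hE0, hE⟩ := exists_rpow_le_of_abs_le_mul A T hA0
  obtain ⟨G, hG⟩ := isCompact_Icc.exists_bound_of_continuousOn hg
  have hRc : Continuous fun x : ℝ => (Real.Gamma x)⁻¹ := (contDiff_inv_Gamma (n := 0)).continuous
  have hR'c : Continuous (deriv fun x : ℝ => (Real.Gamma x)⁻¹) :=
    (contDiff_inv_Gamma (n := 1)).continuous_deriv le_rfl
  obtain ⟨R, hR⟩ := isCompact_Icc.exists_bound_of_continuousOn (hRc.continuousOn (s := Icc 0 2))
  obtain ⟨R', hR'⟩ := isCompact_Icc.exists_bound_of_continuousOn (hR'c.continuousOn (s := Icc 0 2))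
  have hR0 : 0 ≤ R := (norm_nonneg _).trans (hR 0 (by simp))
  have hR'0 : 0 ≤ R' := (norm_nonneg _).trans (hR' 0 (by simp))
  have hG0 : 0 ≤ G := (norm_nonneg _).trans (hG 0 ⟨le_rfl, hT.le⟩)
  set Δ : Set (ℝ × ℝ) := {p | 0 < p.1 ∧ p.1 < p.2 ∧ p.2 < T}
  have hmem1 : ∀ {y τ : ℝ}, 0 < y → y < τ → τ < T → y ∈ Icc 0 T ∧ τ ∈ Icc 0 T ∧
      1 - α τ + α y ∈ Icc (0 : ℝ) 2 := by
    intro y τ h0 h1 h2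
    have hy : y ∈ Icc 0 T := ⟨h0.le, (h1.trans h2).le⟩
    have hτ : τ ∈ Icc 0 T := ⟨(h0.trans h1).le, h2.le⟩
    have := hbound y hy
    have := hbound τ hτ
    exact ⟨hy, hτ, by constructor <;> linarith⟩
  have hpow : ∀ {y τ : ℝ}, 0 < y → y < τ → τ < T →
      |(τ - y) ^ (α y - α τ)| ≤ E ∧ |α y - α τ| ≤ A * (τ - y) := by
    intro y τ h0 h1 h2
    obtain ⟨hy, hτ, -⟩ := hmem1 h0 h1 h2
    have h3 := hLip y hy τ hτ
    rw [abs_sub_comm y, abs_of_pos (sub_pos.2 h1)] at h3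
    refine ⟨?_, h3⟩
    rw [abs_of_nonneg (Real.rpow_nonneg (sub_pos.2 h1).le _)]
    exact hE _ _ (sub_pos.2 h1) (by linarith) h3
  have hK : ∀ {y τ : ℝ}, 0 < y → y < τ → τ < T →
      |(τ - y) ^ (α y - α τ) / Real.Gamma (1 - α τ + α y)| ≤ E * R := by
    intro y τ h0 h1 h2
    rw [div_eq_mul_inv, abs_mul]
    exact mul_le_mul (hpow h0 h1 h2).1 (hR _ (hmem1 h0 h1 h2).2.2) (abs_nonneg _) hE0.le
  have hNeq : ∀ {y τ : ℝ}, 0 < y → y < τ → τ < T → N y τ = (τ - y) ^ (α y - α τ) *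
      ((-α' τ * Real.log (τ - y) + (α y - α τ) / (τ - y)) * (Real.Gamma (1 - α τ + α y))⁻¹ -
        deriv (fun x : ℝ => (Real.Gamma x)⁻¹) (1 - α τ + α y) * α' τ) := by
    intro y τ h0 h1 h2
    exact (hN y τ h0.le h1 h2.le).unique
      (hasDerivAt_sub_rpow_div_Gamma (hα' τ ⟨h0.trans h1, h2⟩) h1)
  have hm1 : MapsTo (Prod.fst : ℝ × ℝ → ℝ) Δ (Icc 0 T) :=
    fun p hp => (hmem1 hp.1 hp.2.1 hp.2.2).1
  have hm2 : MapsTo (Prod.snd : ℝ × ℝ → ℝ) Δ (Icc 0 T) :=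
    fun p hp => (hmem1 hp.1 hp.2.1 hp.2.2).2.1
  have hα1 : ContinuousOn (fun p : ℝ × ℝ => α p.1) Δ := hα.continuousOn.comp continuousOn_fst hm1
  have hα2 : ContinuousOn (fun p : ℝ × ℝ => α p.2) Δ := hα.continuousOn.comp continuousOn_snd hm2
  have hα'2 : ContinuousOn (fun p : ℝ × ℝ => α' p.2) Δ := hα'c.comp continuousOn_snd hm2
  have hg1 : ContinuousOn (fun p : ℝ × ℝ => g p.1) Δ := hg.comp continuousOn_fst hm1
  have hne : ∀ p ∈ Δ, p.2 - p.1 ≠ 0 := fun p hp => (sub_pos.2 hp.2.1).ne'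
  have hw : ContinuousOn (fun p : ℝ × ℝ => p.2 - p.1) Δ := by fun_prop
  have hpc : ContinuousOn (fun p : ℝ × ℝ => (p.2 - p.1) ^ (α p.1 - α p.2)) Δ :=
    hw.rpow (hα1.sub hα2) fun p hp => Or.inl (hne p hp)
  have harg : ContinuousOn (fun p : ℝ × ℝ => 1 - α p.2 + α p.1) Δ :=
    (continuousOn_const.sub hα2).add hα1
  have hR1 := hRc.comp_continuousOn harg
  have hR2 := hR'c.comp_continuousOn harg
  have hNc : ContinuousOn (fun p : ℝ × ℝ => N p.1 p.2) Δ := by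
    refine ContinuousOn.congr (hpc.mul ((((hα'2.neg.mul (hw.log hne)).add
      ((hα1.sub hα2).div hw hne)).mul hR1).sub (hR2.mul hα'2))) ?_
    exact fun p hp => hNeq hp.1 hp.2.1 hp.2.2
  have hcomp : ∀ᶠ τ in 𝓝 t, (∫ s in (0:ℝ)..τ, (τ - s) ^ (-α τ) / Real.Gamma (1 - α τ) *
      ∫ y in (0:ℝ)..s, (s - y) ^ (α y - 1) / Real.Gamma (α y) * g y) =
      ∫ y in (0 : ℝ)..τ, (τ - y) ^ (α y - α τ) / Real.Gamma (1 - α τ + α y) * g y := by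
    filter_upwards [Ioo_mem_nhds ht.1 ht.2] with τ hτ
    have hsub : Icc 0 τ ⊆ Icc 0 T := Icc_subset_Icc_right hτ.2.le
    refine integral_rpow_mul_integral_rpow_eq hτ.1
      ((hbound τ ⟨hτ.1.le, hτ.2.le⟩).2.trans_lt hhi) (hα.continuousOn.mono hsub)
      (fun y hy => hlo.trans_le (hbound y (hsub hy)).1) (hg.mono hsub)
      fun y h0 h1 => hK h0 h1 hτ.2
  refine HasDerivAt.congr_of_eventuallyEq ?_ hcomp
  refine hasDerivAt_integral_of_antitone_bound (C := E * R * G)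
    (n := fun y τ => N y τ * g y)
    (φ := fun u => (E * ((A * (2 * |Real.log T| - Real.log u) + A) * R + R' * A)) * G)
    ht ?_ ?_ ?_ ?_ ?_ ?_ ?_ ?_
  · exact (hpc.mul hR1).mul hg1
  · intro y τ h0 h1 h2
    rw [abs_mul]
    exact mul_le_mul (hK h0 h1 h2) (hG y (hmem1 h0 h1 h2).1) (abs_nonneg _)
      (mul_nonneg hE0.le hR0)
  · intro y τ h0 h1 h2
    exact (hN y τ h0.le h1 h2.le).mul_const (g y)
  · exact hNc.mul hg1
  · intro y τ h0 h1 h2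
    obtain ⟨hy, hτ, h3⟩ := hmem1 h0 h1 h2
    have hwp : 0 < τ - y := sub_pos.2 h1
    have hlog := abs_log_le_two_mul_abs_log_sub_log hwp (show τ - y ≤ T by linarith)
    have hlog0 := (abs_nonneg _).trans hlog
    have hdiv : |(α y - α τ) / (τ - y)| ≤ A := by
      rw [abs_div, abs_of_pos hwp, div_le_iff₀ hwp]
      exact (hpow h0 h1 h2).2
    have hRb := hR _ h3
    have hR'b := hR' _ h3
    have hAτ := hα'A τ hτ
    rw [Real.norm_eq_abs] at hRb hR'b
    rw [abs_mul, hNeq h0 h1 h2, abs_mul]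
    refine mul_le_mul (mul_le_mul (hpow h0 h1 h2).1 ?_ (abs_nonneg _) hE0.le) (hG y hy)
      (abs_nonneg _) (by positivity)
    refine (abs_sub _ _).trans (add_le_add ?_ ?_)
    · rw [abs_mul]
      refine mul_le_mul ((abs_add_le _ _).trans (add_le_add ?_ hdiv)) hRb (abs_nonneg _)
        (by positivity)
      rw [abs_mul, abs_neg]
      exact mul_le_mul hAτ hlog (abs_nonneg _) hA0
    · rw [abs_mul]
      exact mul_le_mul hR'b hAτ (abs_nonneg _) hR'0
  · intro u hu v hv huv
    have := Real.log_le_log hu.1 huv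
    dsimp only
    gcongr
  · have hlogi : IntegrableOn Real.log (Ioo 0 T) :=
      (intervalIntegrable_iff_integrableOn_Ioo_of_le hT.le).1
        intervalIntegral.intervalIntegrable_log'
    have hc : ∀ c : ℝ, IntegrableOn (fun _ => c) (Ioo 0 T) :=
      fun c => integrableOn_const (by simp)
    exact ((((((((hc _).sub hlogi).const_mul A).add (hc A)).mul_const R).add
      (hc (R' * A))).const_mul E).mul_const G)
  · have hmem := Icc_mem_nhds ht.1 ht.2
    have h1 := tendsto_sub_rpow_div_Gamma_diagonal ht (hα' t ht).continuousAt hLip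
    have h2 : Tendsto (fun p : ℝ × ℝ => g p.1) (𝓝[{p | p.1 < p.2}] (t, t)) (𝓝 (g t)) :=
      (hg.continuousAt hmem).tendsto.comp
        ((continuous_fst.tendsto (t, t)).mono_left nhdsWithin_le_nhds)
    have h3 := h1.mul h2
    rw [one_mul] at h3
    exact h3
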